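/- Let B be the open unit ball in ℂ^n and let φ: B → ℝ be a smooth function whose complex Hessian g_{ij̄} = ∂_i∂_j̄φ is a positive definite Hermitian matrix at every point, and suppose the associated Kähler metric has constant holomorphic sectional curvature κ = 2, i.e. R_{ij̄kl̄} = g_{ij̄}g_{kl̄} + g_{il̄}g_{kj̄} everywhere. Then for every point p ∈ B there exist an open neighborhood U ⊆ B of p and an injective holomorphic map f: U → ℂ^n such that g_{ij̄}(z) = ∂_i∂_j̄ [log(1 + |f(z)|²)] for all z ∈ U and all 1 ≤ i,j ≤ n. -/

import Mathlib

noncomputable section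
open Complex Matrix
open scoped ComplexOrder

/-- The Wirtinger derivative `∂ₖ f = (1/2)(∂f/∂xᵏ − i ∂f/∂yᵏ)` of a complex-valued
function on `ℂⁿ` (with its Euclidean structure), where `zᵏ = xᵏ + i yᵏ`. -/
def wd {n : ℕ} (k : Fin n) (f : EuclideanSpace ℂ (Fin n) → ℂ)
    (z : EuclideanSpace ℂ (Fin n)) : ℂ :=
  (1/2 : ℂ) * (fderiv ℝ f z (EuclideanSpace.single k 1)
    - Complex.I * fderiv ℝ f z (EuclideanSpace.single k Complex.I))

/-- The conjugate Wirtinger derivative `∂ₖ̄ f = (1/2)(∂f/∂xᵏ + i ∂f/∂yᵏ)`. -/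
def wdb {n : ℕ} (k : Fin n) (f : EuclideanSpace ℂ (Fin n) → ℂ)
    (z : EuclideanSpace ℂ (Fin n)) : ℂ :=
  (1/2 : ℂ) * (fderiv ℝ f z (EuclideanSpace.single k 1)
    + Complex.I * fderiv ℝ f z (EuclideanSpace.single k Complex.I))

/-- The inverse transpose matrix `(g^{ij̄})` of a matrix-valued function `(g_{ij̄})`. -/
def ginv {n : ℕ} (g : Fin n → Fin n → EuclideanSpace ℂ (Fin n) → ℂ)
    (z : EuclideanSpace ℂ (Fin n)) : Matrix (Fin n) (Fin n) ℂ :=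
  ((Matrix.of fun i j => g i j z)⁻¹)ᵀ

/-- The Riemann curvature tensor
`R_{ij̄kl̄} = −∂_k∂_l̄ g_{ij̄} + g^{pq̄}(∂_l̄ g_{pj̄})(∂_k g_{iq̄})`. -/
def Riem {n : ℕ} (g : Fin n → Fin n → EuclideanSpace ℂ (Fin n) → ℂ)
    (i j k l : Fin n) (z : EuclideanSpace ℂ (Fin n)) : ℂ :=
  - wd k (wdb l (g i j)) z
    + ∑ p, ∑ q, ginv g z p q * wdb l (g p j) z * wd k (g i q) z

/-- The complex Hessian `g_{ij̄} = ∂_i ∂_j̄ φ` of a real-valued function `φ`. -/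
def gmat {n : ℕ} (φ : EuclideanSpace ℂ (Fin n) → ℝ) (i j : Fin n)
    (z : EuclideanSpace ℂ (Fin n)) : ℂ :=
  wd i (wdb j (fun w => (φ w : ℂ))) z

section Helpers
section
open Complex Matrix
open scoped ComplexOrder
open Filter Topology unitInterval

lemma exists_global_ext {E F : Type} [NormedAddCommGroup E] [NormedSpace ℝ E] [FiniteDimensional ℝ E]
    [NormedAddCommGroup F] [NormedSpace ℝ F] (f : E → F) (p : E)
    (h : ∀ᶠ z in 𝓝 p, ContDiffAt ℝ (⊤ : ℕ∞) f z) :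
    ∃ g : E → F, ContDiff ℝ (⊤ : ℕ∞) g ∧ g =ᶠ[𝓝 p] f := by
  obtain ⟨r, hr, hb⟩ := Metric.eventually_nhds_iff_ball.1 h
  let χ : ContDiffBump p := ⟨r / 4, r / 2, by positivity, by linarith⟩
  refine ⟨fun z => χ z • f z, ?_, ?_⟩
  · rw [contDiff_iff_contDiffAt]
    intro x
    by_cases hx : x ∈ Metric.ball p r
    · exact χ.contDiffAt.smul (hb x hx)
    · have : (fun z => χ z • f z) =ᶠ[𝓝 x] fun _ => 0 := by
        have hx' : x ∈ (Metric.closedBall p (r/2))ᶜ := by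
          simp only [Metric.mem_ball, not_lt, Set.mem_compl_iff, Metric.mem_closedBall, not_le] at *
          linarith
        filter_upwards [Metric.isClosed_closedBall.isOpen_compl.mem_nhds hx'] with y hy
        have : χ y = 0 := χ.zero_of_le_dist (by
          simp only [Set.mem_compl_iff, Metric.mem_closedBall, not_le] at hy
          exact hy.le)
        simp [this]
      exact contDiffAt_const.congr_of_eventuallyEq this
  · filter_upwards [χ.eventuallyEq_one] with y hy
    simp [hy]

/-- Restriction of a continuous map to the segments issuing from `p`. -/
noncomputable def raym {E F : Type} [NormedAddCommGroup E] [NormedSpace ℝ E]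
    [TopologicalSpace F] (p : E) (g : C(E, F)) (z : E) : C(I, F) :=
  ⟨fun s => g (p + (s : ℝ) • z), by fun_prop⟩

lemma raym_continuous {E F : Type} [NormedAddCommGroup E] [NormedSpace ℝ E]
    [NormedAddCommGroup F] (p : E) (g : C(E, F)) : Continuous (raym p g) := by
  refine ContinuousMap.continuous_of_continuous_uncurry _ ?_
  show Continuous fun q : E × I => g (p + (q.2 : ℝ) • q.1)
  fun_prop

/-- Evaluation of a path of linear maps. -/
noncomputable def pathEval (𝕜 E F : Type) [NontriviallyNormedField 𝕜]
    [NormedAddCommGroup E] [NormedSpace 𝕜 E]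
    [NormedAddCommGroup F] [NormedSpace 𝕜 F] :
    C(I, E →L[𝕜] F) →L[𝕜] E →L[𝕜] C(I, F) :=
  LinearMap.mkContinuous₂
    (LinearMap.mk₂ 𝕜 (fun (m : C(I, E →L[𝕜] F)) (v : E) => (⟨fun s => m s v, by fun_prop⟩ : C(I, F)))
      (by intros; ext; simp) (by intros; ext; simp) (by intros; ext; simp) (by intros; ext; simp)) 1
    (by
      intro m v
      rw [ContinuousMap.norm_le _ (by positivity)]
      intro s
      simp only [LinearMap.mk₂_apply, ContinuousMap.coe_mk, one_mul]
      exact (m s).le_of_opNorm_le (m.norm_coe_le_norm s) v)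

@[simp] lemma pathEval_apply (𝕜 E F : Type) [NontriviallyNormedField 𝕜]
    [NormedAddCommGroup E] [NormedSpace 𝕜 E]
    [NormedAddCommGroup F] [NormedSpace 𝕜 F] (m : C(I, E →L[𝕜] F)) (v : E) (s : I) :
    pathEval 𝕜 E F m v s = m s v := rfl

/-- multiplication by the parameter. -/
noncomputable def pathMul (G : Type) [NormedAddCommGroup G] [NormedSpace ℝ G] :
    C(I, G) →L[ℝ] C(I, G) :=
  LinearMap.mkContinuous
    { toFun := fun m => ⟨fun s => (s : ℝ) • m s, by fun_prop⟩
      map_add' := by intros; ext; simp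
      map_smul' := by intro c m; ext s; simp [smul_comm c (s : ℝ)] } 1
    (by
      intro m
      rw [ContinuousMap.norm_le _ (by positivity)]
      intro s
      simp only [LinearMap.coe_mk, AddHom.coe_mk, ContinuousMap.coe_mk, norm_smul]
      have h1 : ‖(s : ℝ)‖ ≤ 1 := by
        rw [Real.norm_eq_abs, abs_of_nonneg s.2.1]; exact s.2.2
      exact mul_le_mul h1 (m.norm_coe_le_norm s) (norm_nonneg _) zero_le_one)

@[simp] lemma pathMul_apply (G : Type) [NormedAddCommGroup G] [NormedSpace ℝ G]
    (m : C(I, G)) (s : I) : pathMul G m s = (s : ℝ) • m s := rfl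

lemma raym_hasFDerivAt {E F : Type} [NormedAddCommGroup E] [NormedSpace ℝ E]
    [NormedAddCommGroup F] [NormedSpace ℝ F] (p : E) (g : C(E, F)) (hg : Differentiable ℝ g)
    (hg' : Continuous (fderiv ℝ g)) (z : E) :
    HasFDerivAt (raym p g) (pathEval ℝ E F (pathMul _ (raym p ⟨fderiv ℝ g, hg'⟩ z))) z := by
  rw [hasFDerivAt_iff_isLittleO, Asymptotics.isLittleO_iff]
  intro ε hε
  have hc := (raym_continuous p (⟨fderiv ℝ g, hg'⟩ : C(E, E →L[ℝ] F))).tendsto z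
  have hc' := Metric.tendsto_nhds.1 hc ε hε
  obtain ⟨δ, hδ, hb⟩ := Metric.eventually_nhds_iff_ball.1 hc'
  filter_upwards [Metric.ball_mem_nhds z hδ] with y hy
  rw [ContinuousMap.norm_le _ (by positivity)]
  intro s
  simp only [ContinuousMap.sub_apply, pathEval_apply, pathMul_apply]
  show ‖g (p + (s:ℝ) • y) - g (p + (s:ℝ) • z) - ((s:ℝ) • fderiv ℝ g (p + (s:ℝ) • z)) (y - z)‖ ≤ _
  have key := (convex_ball z δ).norm_image_sub_le_of_norm_hasFDerivWithin_le' (𝕜 := ℝ)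
    (f := fun y => g (p + (s:ℝ) • y))
    (f' := fun y => (s:ℝ) • fderiv ℝ g (p + (s:ℝ) • y))
    (φ := (s:ℝ) • fderiv ℝ g (p + (s:ℝ) • z)) (C := ε)
    (fun x hx => ?_) (fun x hx => ?_) (Metric.mem_ball_self hδ) hy
  · exact key
  · have h1 : HasFDerivAt (fun y => p + (s:ℝ) • y) ((s:ℝ) • ContinuousLinearMap.id ℝ E) x :=
      ((hasFDerivAt_id x).const_smul (s:ℝ)).const_add p
    have h2 := (hg (p + (s:ℝ) • x)).hasFDerivAt.comp x h1
    refine HasFDerivAt.hasFDerivWithinAt ?_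
    have h3 : (s:ℝ) • fderiv ℝ g (p + (s:ℝ) • x)
        = (fderiv ℝ g (p + (s:ℝ) • x)).comp ((s:ℝ) • ContinuousLinearMap.id ℝ E) := by
      ext v; simp
    rw [h3]
    exact h2
  · have h1 : ‖(s : ℝ)‖ ≤ 1 := by
      rw [Real.norm_eq_abs, abs_of_nonneg s.2.1]; exact s.2.2
    rw [← smul_sub, norm_smul]
    have h2 := hb x hx
    rw [dist_eq_norm] at h2
    have h3 := (ContinuousMap.norm_coe_le_norm (raym p ⟨fderiv ℝ g, hg'⟩ x - raym p ⟨fderiv ℝ g, hg'⟩ z) s)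
    have h4 : ‖fderiv ℝ g (p + (s:ℝ) • x) - fderiv ℝ g (p + (s:ℝ) • z)‖ ≤ ε := h3.trans h2.le
    calc _ ≤ 1 * ε := mul_le_mul h1 h4 (norm_nonneg _) zero_le_one
      _ = ε := one_mul _

lemma raym_contDiff {E : Type} [NormedAddCommGroup E] [NormedSpace ℝ E] (p : E) (m : ℕ) :
    ∀ (F : Type) [NormedAddCommGroup F] [NormedSpace ℝ F] (g : C(E, F)), ContDiff ℝ m g →
      ContDiff ℝ m (raym p g) := by
  induction m with
  | zero =>
    intro F _ _ g hg
    simpa using raym_continuous p g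
  | succ m ih =>
    intro F _ _ g hg
    have h1 : ContDiff ℝ 1 g := hg.of_le (by norm_cast; omega)
    have hd := h1.differentiable one_ne_zero
    have hc : Continuous (fderiv ℝ g) := h1.continuous_fderiv one_ne_zero
    refine (contDiff_succ_iff_hasFDerivAt (n := m)).2 ⟨_, ?_, fun z => raym_hasFDerivAt p g hd hc z⟩
    have h2 : ContDiff ℝ m (fderiv ℝ g) := hg.fderiv_right (by norm_cast)
    exact (ContinuousLinearMap.contDiff (E := C(I, E →L[ℝ] F)) (F := E →L[ℝ] C(I, F))
      (pathEval ℝ E F)).comp ((pathMul _).contDiff.comp (ih _ ⟨fderiv ℝ g, hc⟩ h2))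

lemma differentiableAt_complex_of_real {E F : Type} [NormedAddCommGroup E] [NormedSpace ℂ E]
    [NormedAddCommGroup F] [NormedSpace ℂ F] {f : E → F} {x : E} (h : DifferentiableAt ℝ f x)
    (hI : ∀ v, fderiv ℝ f x (Complex.I • v) = Complex.I • fderiv ℝ f x v) :
    DifferentiableAt ℂ f x := by
  rw [differentiableAt_iff_restrictScalars ℝ h]
  refine ⟨{ toFun := fderiv ℝ f x, map_add' := map_add _, map_smul' := ?_, cont := (fderiv ℝ f x).continuous }, ?_⟩
  · intro c v
    have : c • v = c.re • v + c.im • (Complex.I • v) := by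
      conv_lhs => rw [← Complex.re_add_im c]
      rw [add_smul, mul_smul]; rfl
    rw [this, map_add, map_smul, map_smul, hI]
    conv_rhs => rw [RingHom.id_apply, ← Complex.re_add_im c]
    rw [add_smul, mul_smul]; rfl
  · ext v; rfl
end

section
open Complex Matrix
open scoped ComplexOrder
open Filter Topology unitInterval

lemma raym_differentiableAt_complex {E F : Type} [NormedAddCommGroup E] [NormedSpace ℂ E]
    [NormedAddCommGroup F] [NormedSpace ℂ F] (p : E) (g : C(E, F)) (hg : ContDiff ℝ 1 g)
    (hg' : ∀ᶠ z in 𝓝 p, DifferentiableAt ℂ g z) :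
    ∀ᶠ z in 𝓝 (0 : E), DifferentiableAt ℂ (raym p g) z := by
  obtain ⟨r, hr, hb⟩ := Metric.eventually_nhds_iff_ball.1 hg'
  filter_upwards [Metric.ball_mem_nhds (0 : E) hr] with z hz
  have h1 := raym_hasFDerivAt p g (hg.differentiable one_ne_zero) (hg.continuous_fderiv one_ne_zero) z
  refine differentiableAt_complex_of_real h1.differentiableAt ?_
  intro v
  rw [h1.fderiv]
  ext s
  simp only [pathEval_apply, pathMul_apply, ContinuousMap.smul_apply]
  have h2 : DifferentiableAt ℂ g (p + (s:ℝ) • z) := by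
    apply hb
    simp only [Metric.mem_ball, dist_self_add_left, norm_smul, Real.norm_eq_abs, abs_of_nonneg s.2.1]
    have : ‖z‖ < r := by simpa using hz
    nlinarith [s.2.2, s.2.1, norm_nonneg z]
  show ((s:ℝ) • fderiv ℝ g (p + (s:ℝ) • z)) (Complex.I • v)
    = Complex.I • ((s:ℝ) • fderiv ℝ g (p + (s:ℝ) • z)) v
  rw [h2.fderiv_restrictScalars ℝ]
  simp only [_root_.smul_apply, ContinuousLinearMap.coe_restrictScalars', map_smul]
  exact smul_comm _ _ _

/-- The primitive operator on paths. -/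
noncomputable def pathInt (A : Type) [NormedAddCommGroup A] [NormedSpace ℂ A] [CompleteSpace A] :
    C(I, A) →L[ℂ] C(I, A) :=
  LinearMap.mkContinuous
    { toFun := fun m => ⟨fun s => ∫ t in (0:ℝ)..s, Set.IccExtend zero_le_one m t, by
        have h : Continuous fun s : ℝ => ∫ t in (0:ℝ)..s, Set.IccExtend zero_le_one m t :=
          intervalIntegral.continuous_primitive
            (fun a b => (m.continuous.Icc_extend').intervalIntegrable a b) 0
        exact h.comp continuous_subtype_val⟩
      map_add' := by
        intro x y; ext s
        simp only [ContinuousMap.coe_mk, ContinuousMap.add_apply]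
        rw [← intervalIntegral.integral_add ((x.continuous.Icc_extend').intervalIntegrable _ _)
          ((y.continuous.Icc_extend').intervalIntegrable _ _)]
        rfl
      map_smul' := by
        intro c x; ext s
        simp only [ContinuousMap.coe_mk, ContinuousMap.smul_apply, RingHom.id_apply]
        rw [← intervalIntegral.integral_smul]
        rfl } 1
    (by
      intro m
      rw [ContinuousMap.norm_le _ (by positivity)]
      intro s
      simp only [LinearMap.coe_mk, AddHom.coe_mk, ContinuousMap.coe_mk]
      have := intervalIntegral.norm_integral_le_of_norm_le_const (a := 0) (b := (s:ℝ)) (C := ‖m‖)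
        (f := Set.IccExtend zero_le_one m) (fun t _ => m.norm_coe_le_norm _)
      refine this.trans ?_
      rw [sub_zero, abs_of_nonneg s.2.1, one_mul]
      exact mul_le_of_le_one_right (norm_nonneg _) s.2.2)

lemma pathInt_apply (A : Type) [NormedAddCommGroup A] [NormedSpace ℂ A] [CompleteSpace A]
    (m : C(I, A)) (s : I) : pathInt A m s = ∫ t in (0:ℝ)..s, Set.IccExtend zero_le_one m t := rfl

/-- uniqueness for the Lyapunov type equation. -/
lemma lyap_unique {A : Type} [NormedRing A] [NormedAlgebra ℂ A] [StarRing A] [NormedStarGroup A]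
    (b : ℝ → A) (K : NNReal) (hb : ∀ t, ‖b t‖ ≤ K) (f g : ℝ → A)
    (hfd : ∀ t ∈ Set.Icc (0:ℝ) 1, HasDerivAt f (b t * f t + f t * star (b t)) t)
    (hgd : ∀ t ∈ Set.Icc (0:ℝ) 1, HasDerivAt g (b t * g t + g t * star (b t)) t)
    (h0 : f 0 = g 0) : f 1 = g 1 := by
  refine ODE_solution_unique (v := fun t y => b t * y + y * star (b t)) (K := K + K) (a := 0) (b := 1)
    ?_ (fun t ht => (hfd t ht).continuousAt.continuousWithinAt)
    (fun t ht => (hfd t ⟨ht.1, ht.2.le⟩).hasDerivWithinAt)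
    (fun t ht => (hgd t ht).continuousAt.continuousWithinAt)
    (fun t ht => (hgd t ⟨ht.1, ht.2.le⟩).hasDerivWithinAt) h0 ⟨zero_le_one, le_rfl⟩
  intro t
  refine LipschitzWith.of_dist_le_mul fun x y => ?_
  rw [dist_eq_norm, dist_eq_norm]
  have : b t * x + x * star (b t) - (b t * y + y * star (b t))
      = b t * (x - y) + (x - y) * star (b t) := by noncomm_ring
  rw [this]
  refine (norm_add_le _ _).trans ?_
  have h1 := (norm_mul_le (b t) (x - y)).trans (mul_le_mul_of_nonneg_right (hb t) (norm_nonneg _))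
  have h2 := (norm_mul_le (x - y) (star (b t)))
  rw [norm_star] at h2
  have h3 := h2.trans (mul_le_mul_of_nonneg_left (hb t) (norm_nonneg _))
  push_cast
  nlinarith

lemma clm_contDiff_real {P Q : Type} [NormedAddCommGroup P] [NormedSpace ℂ P]
    [NormedAddCommGroup Q] [NormedSpace ℂ Q] (l : P →L[ℂ] Q) : ContDiff ℝ 2 l :=
  l.contDiff.restrict_scalars ℝ

lemma bilin_ray {E M P : Type} [NormedAddCommGroup E] [NormedSpace ℂ E]
    [NormedAddCommGroup M] [NormedSpace ℂ M] [NormedAddCommGroup P] [NormedSpace ℂ P]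
    (B : M →L[ℂ] E →L[ℂ] P) (α : E → M) (h2 : ContDiff ℝ 2 α)
    (hc : ∀ᶠ z in 𝓝 (0 : E), DifferentiableAt ℂ α z) :
    ContDiff ℝ 2 (fun z => B (α z) z) ∧ (∀ᶠ z in 𝓝 (0 : E), DifferentiableAt ℂ (fun z => B (α z) z) z)
      ∧ ∀ v, fderiv ℂ (fun z => B (α z) z) 0 v = B (α 0) v := by
  refine ⟨?_, ?_, ?_⟩
  · have h3 : ContDiff ℝ 2 (fun q : (E →L[ℂ] P) × E => q.1 q.2) :=
      (isBoundedBilinearMap_apply (𝕜 := ℂ)).contDiff.restrict_scalars ℝ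
    exact h3.comp (((clm_contDiff_real B).comp h2).prodMk contDiff_id)
  · filter_upwards [hc] with z hz
    exact (B.differentiableAt.comp z hz).clm_apply differentiableAt_id
  · intro v
    have h1 : DifferentiableAt ℂ (fun z => B (α z)) 0 := B.differentiableAt.comp 0 hc.self_of_nhds
    have h2 : HasFDerivAt (fun z => B (α z) z) _ 0 :=
      h1.hasFDerivAt.clm_apply (hasFDerivAt_id (𝕜 := ℂ) (0 : E))
    rw [h2.fderiv]
    simp

lemma resolvent_ray {E P : Type} [NormedAddCommGroup E] [NormedSpace ℂ E]
    [NormedAddCommGroup P] [NormedSpace ℂ P] [CompleteSpace P]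
    (Lop : P →L[ℂ] P →L[ℂ] P) (one : P) (β : E → P) (hβ2 : ContDiff ℝ 2 β)
    (hβc : ∀ᶠ z in 𝓝 (0 : E), DifferentiableAt ℂ β z) (hβ0 : β 0 = 0) :
    ∃ X : E → P, ContDiffAt ℝ 2 X 0 ∧ (∀ᶠ z in 𝓝 (0 : E), DifferentiableAt ℂ X z) ∧
      (∀ᶠ z in 𝓝 (0 : E), X z = one + Lop (β z) (X z)) ∧ X 0 = one ∧
      ∀ v, fderiv ℂ X 0 v = Lop (fderiv ℂ β 0 v) one := by
  let T : E → (P →L[ℂ] P) := fun z => 1 - Lop (β z)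
  have hT0 : T 0 = 1 := by simp [T, hβ0]
  have hT2 : ContDiff ℝ 2 T := contDiff_const.sub ((clm_contDiff_real Lop).comp hβ2)
  have hTc : ∀ᶠ z in 𝓝 (0 : E), DifferentiableAt ℂ T z := by
    filter_upwards [hβc] with z hz
    exact (differentiableAt_const _).sub (Lop.differentiableAt.comp z hz)
  have hTu : ∀ᶠ z in 𝓝 (0 : E), IsUnit (T z) := by
    have := hT2.continuous.tendsto 0
    rw [hT0] at this
    exact this.eventually (Units.nhds (1 : (P →L[ℂ] P)ˣ))
  let X : E → P := fun z => Ring.inverse (T z) one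
  have hX0 : X 0 = one := by simp [X, hT0]
  have hXc : ∀ᶠ z in 𝓝 (0 : E), DifferentiableAt ℂ X z := by
    filter_upwards [hTc, hTu] with z hz hu
    have h1 : DifferentiableAt ℂ (fun z => Ring.inverse (T z)) z :=
      (differentiableAt_inverse hu).comp z hz
    exact h1.clm_apply (differentiableAt_const _)
  have hXeq : ∀ᶠ z in 𝓝 (0 : E), X z = one + Lop (β z) (X z) := by
    filter_upwards [hTu] with z hu
    have h1 : T z (X z) = one := by
      have := Ring.mul_inverse_cancel _ hu
      exact congrArg (fun q : P →L[ℂ] P => q one) this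
    have h2 : T z (X z) = X z - Lop (β z) (X z) := by
      simp [T]
    rw [h2] at h1
    rw [← h1]; abel
  refine ⟨X, ?_, hXc, hXeq, hX0, ?_⟩
  · have h1 : ContDiffAt ℝ 2 (Ring.inverse : (P →L[ℂ] P) → _) (T 0) := by
      rw [hT0]
      exact (contDiffAt_ringInverse ℂ (1 : (P →L[ℂ] P)ˣ)).restrict_scalars ℝ
    have h2 := h1.comp 0 hT2.contDiffAt
    exact (clm_contDiff_real (ContinuousLinearMap.apply ℂ P one)).contDiffAt.comp 0 h2
  · intro v
    have hLd : HasFDerivAt (fun z => Lop (β z)) (Lop.comp (fderiv ℂ β 0)) 0 :=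
      Lop.hasFDerivAt.comp 0 hβc.self_of_nhds.hasFDerivAt
    have hXd := hLd.clm_apply hXc.self_of_nhds.hasFDerivAt
    have hXd2 := (hXd.const_add one).congr_of_eventuallyEq (f₁ := X) hXeq
    rw [hXd2.fderiv]
    simp [hβ0, hX0]

lemma eval_ray {E P A : Type} [NormedAddCommGroup E] [NormedSpace ℂ E]
    [NormedAddCommGroup P] [NormedSpace ℂ P] [NormedAddCommGroup A] [NormedSpace ℂ A]
    (l : P →L[ℂ] A) (X : E → P) (h2 : ContDiffAt ℝ 2 X 0)
    (hc : ∀ᶠ z in 𝓝 (0 : E), DifferentiableAt ℂ X z) (p : E) :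
    ContDiffAt ℝ 2 (fun z => l (X (z - p))) p ∧
    (∀ᶠ z in 𝓝 p, DifferentiableAt ℂ (fun z => l (X (z - p))) z) ∧
    ∀ v, fderiv ℂ (fun z => l (X (z - p))) p v = l (fderiv ℂ X 0 v) := by
  have htend : Tendsto (fun z : E => z - p) (𝓝 p) (𝓝 0) := by
    have : Continuous fun z : E => z - p := by fun_prop
    simpa using this.tendsto p
  refine ⟨?_, ?_, ?_⟩
  · have h1 : ContDiffAt ℝ 2 X (p - p) := by rwa [sub_self]
    exact (clm_contDiff_real l).contDiffAt.comp p (ContDiffAt.comp (g := X) (f := fun z => z - p) p h1 (contDiffAt_id.sub contDiffAt_const))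
  · filter_upwards [htend.eventually hc] with z h1
    have h3 : DifferentiableAt ℂ (fun z => X (z - p)) z :=
        DifferentiableAt.comp z h1 (differentiableAt_id.sub (differentiableAt_const _))
    exact l.differentiableAt.comp z h3
  · intro v
    have h3 : HasFDerivAt (fun z : E => z - p) (ContinuousLinearMap.id ℂ E) p :=
      (hasFDerivAt_id p).sub_const p
    have h1 : HasFDerivAt X (fderiv ℂ X 0) (p - p) := by
      rw [sub_self]; exact hc.self_of_nhds.hasFDerivAt
    have h4 : HasFDerivAt (fun z => l (X (z - p))) _ p := (l.hasFDerivAt.comp p (HasFDerivAt.comp (g := X) (f := fun z => z - p) p h1 h3))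
    rw [h4.fderiv]
    simp

lemma exists_frame {E A : Type} [NormedAddCommGroup E] [NormedSpace ℂ E]
    [NormedRing A] [NormedAlgebra ℂ A] [CompleteSpace A] [StarRing A] [NormedStarGroup A]
    [StarModule ℂ A] (p : E) (a : E → E →L[ℂ] A) (ha : ContDiff ℝ 2 a)
    (ha' : ∀ᶠ z in 𝓝 p, DifferentiableAt ℂ a z) (H : E → A)
    (hH : ∀ᶠ z in 𝓝 p, DifferentiableAt ℝ H z ∧
      ∀ v, fderiv ℝ H z v = a z v * H z + H z * star (a z v)) :
    ∃ W : E → A, ContDiffAt ℝ 2 W p ∧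
      (∀ᶠ z in 𝓝 p, DifferentiableAt ℂ W z ∧ H z = W z * H p * star (W z)) ∧
      W p = 1 ∧ ∀ v, fderiv ℂ W p v = a p v := by
  let ac : C(E, E →L[ℂ] A) := ⟨a, ha.continuous⟩
  let β : E → C(I, A) := fun z => pathEval ℂ E A (raym p ac z) z
  have hα2 : ContDiff ℝ 2 (raym p ac) := by
    exact_mod_cast raym_contDiff p 2 _ ac (by exact_mod_cast ha)
  have hαc := raym_differentiableAt_complex p ac (ha.of_le (by norm_num)) ha'
  obtain ⟨hβ2, hβc, hβd⟩ := bilin_ray (pathEval ℂ E A) (raym p ac) hα2 hαc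
  have hβ0 : β 0 = 0 := by simp [β]
  let Lop : C(I, A) →L[ℂ] (C(I, A) →L[ℂ] C(I, A)) :=
    (ContinuousLinearMap.compL ℂ C(I, A) C(I, A) C(I, A) (pathInt A)).comp
      (ContinuousLinearMap.mul ℂ C(I, A))
  have hLop : ∀ x y, Lop x y = pathInt A (x * y) := fun x y => rfl
  obtain ⟨X, hX2, hXc, hXeq, hX0, hXd⟩ := resolvent_ray Lop (1 : C(I, A)) β hβ2 hβc hβ0
  obtain ⟨hW2, hWc, hWd⟩ := eval_ray (ContinuousMap.evalCLM ℂ (1 : I)) X hX2 hXc p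
  have htend : Tendsto (fun z : E => z - p) (𝓝 p) (𝓝 0) := by
    have : Continuous fun z : E => z - p := by fun_prop
    simpa using this.tendsto p
  refine ⟨fun z => X (z - p) 1, ?_, ?_, by simp [hX0], ?_⟩
  · exact hW2
  · obtain ⟨r, hr, hb⟩ := Metric.eventually_nhds_iff_ball.1 hH
    filter_upwards [hWc, htend.eventually hXeq, Metric.ball_mem_nhds p hr] with z h1 h2 hz
    constructor
    · exact h1
    · set v := z - p with hv
      set x := X v with hx
      let Y : ℝ → A := fun t => 1 + ∫ s in (0:ℝ)..t, Set.IccExtend zero_le_one (β v * x) s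
      have hYx : ∀ t : I, Y t = x t := by
        intro t
        conv_rhs => rw [h2]
        rfl
      have hYd : ∀ t, HasDerivAt Y (Set.IccExtend zero_le_one (β v * x) t) t := by
        intro t
        refine HasDerivAt.const_add _ ?_
        have hc : Continuous (Set.IccExtend zero_le_one (β v * x)) := (β v * x).continuous.Icc_extend'
        exact intervalIntegral.integral_hasDerivAt_right (hc.intervalIntegrable _ _)
          (hc.stronglyMeasurableAtFilter _ _) hc.continuousAt
      let b : ℝ → A := Set.IccExtend zero_le_one (β v)
      have hbI : ∀ t ∈ Set.Icc (0:ℝ) 1, b t = a (p + t • v) v := by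
        intro t ht
        show Set.IccExtend zero_le_one (β v) t = _
        rw [Set.IccExtend_of_mem _ _ ht]
        rfl
      have hYd' : ∀ t ∈ Set.Icc (0:ℝ) 1, HasDerivAt Y (b t * Y t) t := by
        intro t ht
        have := hYd t
        rw [Set.IccExtend_of_mem _ _ ht] at this
        have e : b t = β v ⟨t, ht⟩ := Set.IccExtend_of_mem _ _ ht
        rw [e, hYx ⟨t, ht⟩]
        exact this
      have key := lyap_unique b ⟨‖β v‖, norm_nonneg _⟩ (fun t => (β v).norm_coe_le_norm _)
        (fun t => H (p + t • v)) (fun t => Y t * H p * star (Y t)) ?_ ?_ ?_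
      · have e1 : Y 1 = x 1 := hYx 1
        simp only [e1, one_smul] at key
        rw [← key, hv]; congr 1; abel
      · intro t ht
        have hmem : p + t • v ∈ Metric.ball p r := by
          simp only [Metric.mem_ball, dist_self_add_left, norm_smul, Real.norm_eq_abs, abs_of_nonneg ht.1]
          have : ‖v‖ < r := by simpa [hv, dist_eq_norm] using hz
          nlinarith [ht.1, ht.2, norm_nonneg v]
        obtain ⟨h3, h4⟩ := hb _ hmem
        rw [hbI t ht, ← h4 v]
        have h5 : HasDerivAt (fun t : ℝ => p + t • v) v t := by
          simpa using ((hasDerivAt_id t).smul_const v).const_add p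
        exact h3.hasFDerivAt.comp_hasDerivAt t h5
      · intro t ht
        have h3 := hYd' t ht
        have h4 := (h3.mul_const (H p)).mul h3.star
        have e : b t * (Y t * H p * star (Y t)) + Y t * H p * star (Y t) * star (b t)
            = b t * Y t * H p * star (Y t) + Y t * H p * star (b t * Y t) := by
          simp [mul_assoc]
        rw [e]
        exact h4
      · simp [Y]
  · intro v
    refine (hWd v).trans ?_
    rw [hXd, hβd]
    show pathInt A (pathEval ℂ E A (raym p ac 0) v * 1) 1 = _
    rw [mul_one, pathInt_apply]
    have : ∀ t, Set.IccExtend zero_le_one (pathEval ℂ E A (raym p ac 0) v) t = a p v := by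
      intro t
      simp [Set.IccExtend, raym, ac]
    simp [this]
end

section
open Complex Matrix
open scoped ComplexOrder
open Filter Topology
open scoped ComplexConjugate

lemma single_I {n : ℕ} (k : Fin n) :
    (EuclideanSpace.single k Complex.I : EuclideanSpace ℂ (Fin n)) = Complex.I • EuclideanSpace.single k 1 := by
  ext i; simp

section W
variable {n : ℕ} {f g : EuclideanSpace ℂ (Fin n) → ℂ} {z : EuclideanSpace ℂ (Fin n)} (k : Fin n)

lemma euclid_decomp (v : EuclideanSpace ℂ (Fin n)) :
    v = ∑ k, ((v k).re • (EuclideanSpace.single k 1 : EuclideanSpace ℂ (Fin n))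
      + (v k).im • (EuclideanSpace.single k Complex.I : EuclideanSpace ℂ (Fin n))) := by
  ext i
  rw [WithLp.ofLp_sum, Finset.sum_apply]
  simp only [PiLp.add_apply, PiLp.smul_apply, PiLp.single_apply]
  rw [Finset.sum_eq_single i]
  · simp
  · intro j _ hj; simp [hj.symm]
  · simp

lemma fderiv_eq_wd (f : EuclideanSpace ℂ (Fin n) → ℂ) (z v : EuclideanSpace ℂ (Fin n)) :
    fderiv ℝ f z v = ∑ k, (v k * wd k f z + conj (v k) * wdb k f z) := by
  conv_lhs => rw [euclid_decomp v]
  rw [map_sum]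
  refine Finset.sum_congr rfl fun k _ => ?_
  rw [map_add, map_smul, map_smul, wd, wdb]
  have h1 : (v k) = (v k).re + (v k).im * Complex.I := (Complex.re_add_im _).symm
  have h2 : conj (v k) = (v k).re - (v k).im * Complex.I := by
    apply Complex.ext <;> simp
  rw [h2]
  conv_rhs => rw [h1]
  simp only [Complex.real_smul, Complex.add_re, Complex.add_im, Complex.ofReal_re, Complex.ofReal_im, Complex.mul_re, Complex.mul_im, Complex.I_re, Complex.I_im]
  ring_nf
  simp only [Complex.I_sq]
  ring_nf

lemma wd_congr (h : f =ᶠ[𝓝 z] g) : wd k f z = wd k g z := by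
  simp only [wd, h.fderiv_eq]
lemma wdb_congr (h : f =ᶠ[𝓝 z] g) : wdb k f z = wdb k g z := by
  simp only [wdb, h.fderiv_eq]

lemma wd_evEq (h : f =ᶠ[𝓝 z] g) : wd k f =ᶠ[𝓝 z] wd k g := by
  filter_upwards [h.eventuallyEq_nhds] with y hy using wd_congr k hy
lemma wdb_evEq (h : f =ᶠ[𝓝 z] g) : wdb k f =ᶠ[𝓝 z] wdb k g := by
  filter_upwards [h.eventuallyEq_nhds] with y hy using wdb_congr k hy

lemma wd_const (c : ℂ) : wd k (fun _ => c) z = 0 := by simp [wd]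
lemma wdb_const (c : ℂ) : wdb k (fun _ => c) z = 0 := by simp [wdb]

lemma wd_add (hf : DifferentiableAt ℝ f z) (hg : DifferentiableAt ℝ g z) :
    wd k (fun z => f z + g z) z = wd k f z + wd k g z := by
  simp only [wd, fderiv_fun_add hf hg, _root_.add_apply]; ring
lemma wdb_add (hf : DifferentiableAt ℝ f z) (hg : DifferentiableAt ℝ g z) :
    wdb k (fun z => f z + g z) z = wdb k f z + wdb k g z := by
  simp only [wdb, fderiv_fun_add hf hg, _root_.add_apply]; ring
lemma wdb_sub (hf : DifferentiableAt ℝ f z) (hg : DifferentiableAt ℝ g z) :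
    wdb k (fun z => f z - g z) z = wdb k f z - wdb k g z := by
  simp only [wdb, fderiv_fun_sub hf hg, _root_.sub_apply]; ring
lemma wd_mul (hf : DifferentiableAt ℝ f z) (hg : DifferentiableAt ℝ g z) :
    wd k (fun z => f z * g z) z = wd k f z * g z + f z * wd k g z := by
  simp only [wd, fderiv_fun_mul hf hg, _root_.add_apply, _root_.smul_apply, smul_eq_mul]; ring
lemma wdb_mul (hf : DifferentiableAt ℝ f z) (hg : DifferentiableAt ℝ g z) :
    wdb k (fun z => f z * g z) z = wdb k f z * g z + f z * wdb k g z := by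
  simp only [wdb, fderiv_fun_mul hf hg, _root_.add_apply, _root_.smul_apply, smul_eq_mul]; ring
lemma wdb_sum {ι : Type} (s : Finset ι) (F : ι → EuclideanSpace ℂ (Fin n) → ℂ)
    (hF : ∀ i ∈ s, DifferentiableAt ℝ (F i) z) :
    wdb k (fun z => ∑ i ∈ s, F i z) z = ∑ i ∈ s, wdb k (F i) z := by
  simp only [wdb, fderiv_fun_sum hF, _root_.sum_apply]
  rw [← Finset.mul_sum, Finset.sum_add_distrib, Finset.mul_sum]
lemma wd_exp (hf : DifferentiableAt ℝ f z) :
    wd k (fun z => Complex.exp (f z)) z = Complex.exp (f z) * wd k f z := by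
  have h := (hf.hasFDerivAt.cexp).fderiv
  simp only [wd, h, _root_.smul_apply, smul_eq_mul]; ring

lemma fderiv_conj (f : EuclideanSpace ℂ (Fin n) → ℂ) (z v : EuclideanSpace ℂ (Fin n)) :
    fderiv ℝ (fun z => conj (f z)) z v = conj (fderiv ℝ f z v) := by
  have := Complex.conjCLE.comp_fderiv (f := f) (x := z)
  exact congrArg (fun L => L v) this
lemma wd_conj (f : EuclideanSpace ℂ (Fin n) → ℂ) : wd k (fun z => conj (f z)) z = conj (wdb k f z) := by
  have h2 : conj (2 : ℂ) = 2 := Complex.conj_ofNat 2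
  simp [wd, wdb, fderiv_conj, h2]; ring
lemma wdb_conj (f : EuclideanSpace ℂ (Fin n) → ℂ) : wdb k (fun z => conj (f z)) z = conj (wd k f z) := by
  have h2 : conj (2 : ℂ) = 2 := Complex.conj_ofNat 2
  simp [wd, wdb, fderiv_conj, h2]

lemma wdb_eq_zero (h : DifferentiableAt ℂ f z) : wdb k f z = 0 := by
  rw [wdb, single_I, h.fderiv_restrictScalars ℝ]
  simp only [ContinuousLinearMap.coe_restrictScalars', map_smul, smul_eq_mul]
  rw [← mul_assoc, Complex.I_mul_I]; ring
lemma wd_eq_fderiv (h : DifferentiableAt ℂ f z) : wd k f z = fderiv ℂ f z (EuclideanSpace.single k 1) := by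
  rw [wd, single_I, h.fderiv_restrictScalars ℝ]
  simp only [ContinuousLinearMap.coe_restrictScalars', map_smul, smul_eq_mul]
  rw [← mul_assoc, Complex.I_mul_I]; ring
lemma differentiableAt_of_wdb (h : DifferentiableAt ℝ f z) (h0 : ∀ k, wdb k f z = 0) :
    DifferentiableAt ℂ f z := by
  refine differentiableAt_complex_of_real h fun v => ?_
  simp only [fderiv_eq_wd, h0, PiLp.smul_apply, smul_eq_mul, Finset.mul_sum, mul_zero, add_zero, mul_assoc]

lemma ContDiffAt.wd' {m m' : WithTop ℕ∞} (hf : ContDiffAt ℝ m f z) (hm : m' + 1 ≤ m) : ContDiffAt ℝ m' (wd k f) z := by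
  have h := hf.fderiv_right hm
  exact contDiffAt_const.mul ((h.clm_apply contDiffAt_const).sub
    (contDiffAt_const.mul (h.clm_apply contDiffAt_const)))
lemma ContDiffAt.wdb' {m m' : WithTop ℕ∞} (hf : ContDiffAt ℝ m f z) (hm : m' + 1 ≤ m) : ContDiffAt ℝ m' (wdb k f) z := by
  have h := hf.fderiv_right hm
  exact contDiffAt_const.mul ((h.clm_apply contDiffAt_const).add
    (contDiffAt_const.mul (h.clm_apply contDiffAt_const)))
lemma ContDiff.wd' (hf : ContDiff ℝ (⊤ : ℕ∞) f) : ContDiff ℝ (⊤ : ℕ∞) (wd k f) :=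
  contDiff_iff_contDiffAt.2 fun _ => hf.contDiffAt.wd' k (by simp)
lemma ContDiff.wdb' (hf : ContDiff ℝ (⊤ : ℕ∞) f) : ContDiff ℝ (⊤ : ℕ∞) (wdb k f) :=
  contDiff_iff_contDiffAt.2 fun _ => hf.contDiffAt.wdb' k (by simp)

lemma fderiv_fderiv_apply (hf : ContDiffAt ℝ 2 f z) (v w : EuclideanSpace ℂ (Fin n)) :
    fderiv ℝ (fun y => fderiv ℝ f y v) z w = fderiv ℝ (fderiv ℝ f) z w v := by
  have h : DifferentiableAt ℝ (fderiv ℝ f) z :=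
    (hf.fderiv_right (m := 1) (by norm_num)).differentiableAt one_ne_zero
  have := (h.hasFDerivAt.clm_apply (hasFDerivAt_const v z)).fderiv
  rw [this]; simp

lemma dd_diff (hf : ContDiffAt ℝ 2 f z) (v : EuclideanSpace ℂ (Fin n)) :
    DifferentiableAt ℝ (fun y => fderiv ℝ f y v) z :=
  ((hf.fderiv_right (m := 1) (by norm_num)).differentiableAt one_ne_zero).clm_apply
    (differentiableAt_const v)

lemma fderiv_wd (hf : ContDiffAt ℝ 2 f z) (v : EuclideanSpace ℂ (Fin n)) :
    fderiv ℝ (wd k f) z v = (1/2 : ℂ) * (fderiv ℝ (fderiv ℝ f) z v (EuclideanSpace.single k 1)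
      - Complex.I * fderiv ℝ (fderiv ℝ f) z v (EuclideanSpace.single k Complex.I)) := by
  rw [← fderiv_fderiv_apply hf, ← fderiv_fderiv_apply hf]
  have h1 := (dd_diff hf (EuclideanSpace.single k 1)).hasFDerivAt
  have h2 := (dd_diff hf (EuclideanSpace.single k Complex.I)).hasFDerivAt
  have h3 := ((h1.sub (h2.const_mul Complex.I)).const_mul (1/2 : ℂ)).fderiv
  have h4 : fderiv ℝ (wd k f) z = _ := h3
  rw [h4]; simp
lemma fderiv_wdb (hf : ContDiffAt ℝ 2 f z) (v : EuclideanSpace ℂ (Fin n)) :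
    fderiv ℝ (wdb k f) z v = (1/2 : ℂ) * (fderiv ℝ (fderiv ℝ f) z v (EuclideanSpace.single k 1)
      + Complex.I * fderiv ℝ (fderiv ℝ f) z v (EuclideanSpace.single k Complex.I)) := by
  rw [← fderiv_fderiv_apply hf, ← fderiv_fderiv_apply hf]
  have h1 := (dd_diff hf (EuclideanSpace.single k 1)).hasFDerivAt
  have h2 := (dd_diff hf (EuclideanSpace.single k Complex.I)).hasFDerivAt
  have h3 := ((h1.add (h2.const_mul Complex.I)).const_mul (1/2 : ℂ)).fderiv
  have h4 : fderiv ℝ (wdb k f) z = _ := h3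
  rw [h4]; simp; ring

lemma dd_symm (hf : ContDiffAt ℝ 2 f z) (v w : EuclideanSpace ℂ (Fin n)) :
    fderiv ℝ (fderiv ℝ f) z v w = fderiv ℝ (fderiv ℝ f) z w v :=
  (hf.isSymmSndFDerivAt (by simp)) v w

lemma wd_wdb_comm (hf : ContDiffAt ℝ 2 f z) (i j : Fin n) :
    wd i (wdb j f) z = wdb j (wd i f) z := by
  rw [wd, wdb, fderiv_wd _ hf, fderiv_wd _ hf, fderiv_wdb _ hf, fderiv_wdb _ hf]
  rw [dd_symm hf (EuclideanSpace.single j 1), dd_symm hf (EuclideanSpace.single j 1),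
    dd_symm hf (EuclideanSpace.single j Complex.I), dd_symm hf (EuclideanSpace.single j Complex.I)]
  ring
lemma wd_wd_comm (hf : ContDiffAt ℝ 2 f z) (i j : Fin n) :
    wd i (wd j f) z = wd j (wd i f) z := by
  rw [wd, wd, fderiv_wd _ hf, fderiv_wd _ hf, fderiv_wd _ hf, fderiv_wd _ hf]
  rw [dd_symm hf (EuclideanSpace.single j 1), dd_symm hf (EuclideanSpace.single j 1),
    dd_symm hf (EuclideanSpace.single j Complex.I), dd_symm hf (EuclideanSpace.single j Complex.I)]
  ring
end W
end

section
open Complex Matrix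
open scoped ComplexOrder
open Filter Topology
open scoped ComplexConjugate

lemma contDiffAt_det {ι : Type} [Fintype ι] [DecidableEq ι] {E : Type} [NormedAddCommGroup E] [NormedSpace ℝ E]
    (M : E → Matrix ι ι ℂ) {z : E} {m : WithTop ℕ∞}
    (h : ∀ i j, ContDiffAt ℝ m (fun z => M z i j) z) : ContDiffAt ℝ m (fun z => (M z).det) z := by
  simp only [Matrix.det_apply]
  refine ContDiffAt.sum fun σ _ => ?_
  have : ContDiffAt ℝ m (fun z => ∏ i, M z (σ i) i) z := contDiffAt_prod fun i _ => h _ _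
  exact this.const_smul _

lemma contDiffAt_inv_entry {ι : Type} [Fintype ι] [DecidableEq ι] {E : Type} [NormedAddCommGroup E] [NormedSpace ℝ E]
    (M : E → Matrix ι ι ℂ) {z : E} {m : WithTop ℕ∞}
    (h : ∀ i j, ContDiffAt ℝ m (fun z => M z i j) z) (hd : (M z).det ≠ 0) (i j : ι) :
    ContDiffAt ℝ m (fun z => (M z)⁻¹ i j) z := by
  have e : ∀ z, (M z)⁻¹ i j = ((M z).det)⁻¹ * ((M z).updateRow j (Pi.single i 1)).det := by
    intro z
    rw [Matrix.inv_def, Matrix.smul_apply, Ring.inverse_eq_inv', smul_eq_mul, Matrix.adjugate_apply]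
  simp only [e]
  refine ((contDiffAt_det M h).inv hd).mul (contDiffAt_det _ fun a b => ?_)
  by_cases hab : a = j
  · subst hab
    simp only [Matrix.updateRow_self]
    exact contDiffAt_const
  · simp only [Matrix.updateRow_ne hab]
    exact h a b

section G
variable {n : ℕ} (φ : EuclideanSpace ℂ (Fin n) → ℝ)

/-- complexified potential -/
def Phi (z : EuclideanSpace ℂ (Fin n)) : ℂ := (φ z : ℂ)
/-- first derivatives of the potential -/
def ph (i : Fin n) : EuclideanSpace ℂ (Fin n) → ℂ := wd i (Phi φ)
/-- Christoffel symbols -/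
def Gam (m k i : Fin n) (z : EuclideanSpace ℂ (Fin n)) : ℂ :=
  ∑ q, ginv (gmat φ) z m q * wd k (gmat φ i q) z

/-- connection matrices -/
def Acon (k : Fin n) (z : EuclideanSpace ℂ (Fin n)) : Option (Fin n) → Option (Fin n) → ℂ
  | none, none => 0
  | none, some m => if m = k then 1 else 0
  | some i, none => wd k (ph φ i) z - ph φ k z * ph φ i z - ∑ m, Gam φ m k i z * ph φ m z
  | some i, some m => Gam φ m k i z + ph φ k z * (if m = i then 1 else 0) + ph φ i z * (if m = k then 1 else 0)

/-- the jet metric -/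
def Hmet (z : EuclideanSpace ℂ (Fin n)) : Option (Fin n) → Option (Fin n) → ℂ
  | none, none => Complex.exp (Phi φ z)
  | none, some j => Complex.exp (Phi φ z) * conj (ph φ j z)
  | some i, none => Complex.exp (Phi φ z) * ph φ i z
  | some i, some j => Complex.exp (Phi φ z) * (gmat φ i j z + ph φ i z * conj (ph φ j z))

variable {φ}

lemma Phi_smooth (hφ : ContDiff ℝ (⊤ : ℕ∞) φ) : ContDiff ℝ (⊤ : ℕ∞) (Phi φ) := Complex.ofRealCLM.contDiff.comp hφ
lemma ph_smooth (hφ : ContDiff ℝ (⊤ : ℕ∞) φ) (i : Fin n) : ContDiff ℝ (⊤ : ℕ∞) (ph φ i) := (Phi_smooth hφ).wd' i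
lemma conj_ph (i : Fin n) (z) : conj (ph φ i z) = wdb i (Phi φ) z := by
  rw [ph, ← wdb_conj]; congr 1; funext w; simp [Phi]
lemma cph_smooth (hφ : ContDiff ℝ (⊤ : ℕ∞) φ) (i : Fin n) : ContDiff ℝ (⊤ : ℕ∞) (fun z => conj (ph φ i z)) := by
  simp only [conj_ph]; exact (Phi_smooth hφ).wdb' i
lemma g_smooth (hφ : ContDiff ℝ (⊤ : ℕ∞) φ) (i j : Fin n) : ContDiff ℝ (⊤ : ℕ∞) (gmat φ i j) := ((Phi_smooth hφ).wdb' j).wd' i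

lemma wd_cph (hφ : ContDiff ℝ (⊤ : ℕ∞) φ) (k j : Fin n) (z) : wd k (fun z => conj (ph φ j z)) z = gmat φ k j z := by
  simp only [conj_ph]; rfl
lemma smooth2 (hφ : ContDiff ℝ (⊤ : ℕ∞) φ) {f : EuclideanSpace ℂ (Fin n) → ℂ} (hf : ContDiff ℝ (⊤ : ℕ∞) f) (z) : ContDiffAt ℝ 2 f z :=
  (hf.of_le (WithTop.coe_le_coe.2 le_top)).contDiffAt
lemma wdb_ph (hφ : ContDiff ℝ (⊤ : ℕ∞) φ) (i l : Fin n) (z) : wdb l (ph φ i) z = gmat φ i l z :=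
  (wd_wdb_comm (smooth2 hφ (Phi_smooth hφ) z) i l).symm
lemma conj_g (hφ : ContDiff ℝ (⊤ : ℕ∞) φ) (i j : Fin n) (z) : conj (gmat φ i j z) = gmat φ j i z := by
  rw [← wd_cph hφ, ← wdb_conj, ← wdb_ph hφ]; simp
lemma wd_g_symm (hφ : ContDiff ℝ (⊤ : ℕ∞) φ) (k i j : Fin n) (z) : wd k (gmat φ i j) z = wd i (gmat φ k j) z :=
  wd_wd_comm (smooth2 hφ ((Phi_smooth hφ).wdb' j) z) k i

lemma smd (hφ : ContDiff ℝ (⊤ : ℕ∞) φ) {f : EuclideanSpace ℂ (Fin n) → ℂ} (hf : ContDiff ℝ (⊤ : ℕ∞) f) (z) : DifferentiableAt ℝ f z :=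
  hf.differentiable (by simp) z

lemma conj_H (hφ : ContDiff ℝ (⊤ : ℕ∞) φ) (z) (A B : Option (Fin n)) : conj (Hmet φ z A B) = Hmet φ z B A := by
  have h : conj (Complex.exp (Phi φ z)) = Complex.exp (Phi φ z) := by
    rw [← Complex.exp_conj]; simp [Phi]
  rcases A with _ | i <;> rcases B with _ | j <;> simp [Hmet, h, conj_g hφ, mul_comm]

lemma H_smooth (hφ : ContDiff ℝ (⊤ : ℕ∞) φ) (A B : Option (Fin n)) : ContDiff ℝ (⊤ : ℕ∞) (fun z => Hmet φ z A B) := by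
  have he : ContDiff ℝ (⊤ : ℕ∞) (fun z => Complex.exp (Phi φ z)) := (Phi_smooth hφ).cexp
  rcases A with _ | i <;> rcases B with _ | j <;> simp only [Hmet]
  · exact he
  · exact he.mul (cph_smooth hφ j)
  · exact he.mul (ph_smooth hφ i)
  · exact he.mul ((g_smooth hφ i j).add ((ph_smooth hφ i).mul (cph_smooth hφ j)))

lemma Gam_smooth (hφ : ContDiff ℝ (⊤ : ℕ∞) φ) {z} (hd : (Matrix.of fun i j => gmat φ i j z).det ≠ 0) (m k i : Fin n) :
    ContDiffAt ℝ (⊤ : ℕ∞) (Gam φ m k i) z := by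
  refine ContDiffAt.sum fun q _ => ContDiffAt.mul ?_ ((g_smooth hφ i q).wd' k).contDiffAt
  exact contDiffAt_inv_entry (fun z => Matrix.of fun i j => gmat φ i j z)
    (fun i j => (g_smooth hφ i j).contDiffAt) hd q m

lemma Gam_g {z} (hd : (Matrix.of fun i j => gmat φ i j z).det ≠ 0) (k i j : Fin n) :
    ∑ m, Gam φ m k i z * gmat φ m j z = wd k (gmat φ i j) z := by
  have h := Matrix.nonsing_inv_mul (Matrix.of fun i j => gmat φ i j z) (isUnit_iff_ne_zero.2 hd)
  have h' : ∀ q, ∑ m, ginv (gmat φ) z m q * gmat φ m j z = if q = j then 1 else 0 := by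
    intro q
    have := congrFun (congrFun h q) j
    rw [Matrix.mul_apply, Matrix.one_apply] at this
    exact this
  simp only [Gam, Finset.sum_mul]
  rw [Finset.sum_comm]
  calc _ = ∑ q, wd k (gmat φ i q) z * ∑ m, ginv (gmat φ) z m q * gmat φ m j z := by
        refine Finset.sum_congr rfl fun q _ => ?_
        rw [Finset.mul_sum]
        refine Finset.sum_congr rfl fun m _ => by ring
    _ = _ := by simp [h']

lemma wdb_Gam (hφ : ContDiff ℝ (⊤ : ℕ∞) φ) {z} (hd : ∀ᶠ y in 𝓝 z, (Matrix.of fun i j => gmat φ i j y).det ≠ 0)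
    (hc : ∀ i j k l : Fin n,
      Riem (gmat φ) i j k l z
        = gmat φ i j z * gmat φ k l z + gmat φ i l z * gmat φ k j z) (m k i l : Fin n) :
    wdb l (Gam φ m k i) z = - ((if m = i then 1 else 0) * gmat φ k l z
      + (if m = k then 1 else 0) * gmat φ i l z) := by
  have hd0 := hd.self_of_nhds
  let D : Fin n → ℂ := fun m => wdb l (Gam φ m k i) z + ((if m = i then 1 else 0) * gmat φ k l z
      + (if m = k then 1 else 0) * gmat φ i l z)
  have hG : ∀ m, DifferentiableAt ℝ (Gam φ m k i) z := fun m =>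
    (Gam_smooth hφ hd0 m k i).differentiableAt (by simp)
  have key : ∀ j, ∑ m, D m * gmat φ m j z = 0 := by
    intro j
    have e : (fun y => ∑ m, Gam φ m k i y * gmat φ m j y) =ᶠ[𝓝 z] wd k (gmat φ i j) := by
      filter_upwards [hd] with y hy using Gam_g hy k i j
    have e2 := wdb_congr l e
    rw [wdb_sum l _ _ (fun m _ => (hG m).fun_mul (smd hφ (g_smooth hφ m j) z))] at e2
    simp only [wdb_mul l (hG _) (smd hφ (g_smooth hφ _ j) z)] at e2
    rw [← wd_wdb_comm (smooth2 hφ (g_smooth hφ i j) z)] at e2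
    have h3 := hc i j k l
    rw [Riem] at h3
    have h4 : ∑ p, ∑ q, ginv (gmat φ) z p q * wdb l (gmat φ p j) z * wd k (gmat φ i q) z
        = ∑ p, Gam φ p k i z * wdb l (gmat φ p j) z := by
      refine Finset.sum_congr rfl fun p _ => ?_
      rw [Gam, Finset.sum_mul]
      refine Finset.sum_congr rfl fun q _ => by ring
    rw [h4, ← e2, Finset.sum_add_distrib] at h3
    simp only [D, add_mul, Finset.sum_add_distrib]
    simp only [ite_mul, one_mul, zero_mul, Finset.sum_ite_eq', Finset.sum_ite_eq, Finset.mem_univ, if_true]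
    linear_combination -h3
  have hD : D = 0 := by
    have : D ᵥ* (Matrix.of fun i j => gmat φ i j z) = 0 := by
      funext j
      simpa [Matrix.vecMul, dotProduct] using key j
    exact Matrix.eq_zero_of_vecMul_eq_zero hd0 this
  have := congrFun hD m
  simp only [D, Pi.zero_apply] at this
  linear_combination this

lemma wd_H (hφ : ContDiff ℝ (⊤ : ℕ∞) φ) {z} (hd : (Matrix.of fun i j => gmat φ i j z).det ≠ 0) (k : Fin n) (A B : Option (Fin n)) :
    wd k (fun y => Hmet φ y A B) z = ∑ C, Acon φ k z A C * Hmet φ z C B := by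
  have hP := smd hφ (Phi_smooth hφ) z
  have he : DifferentiableAt ℝ (fun z => Complex.exp (Phi φ z)) z := hP.cexp
  have hph := fun i => smd hφ (ph_smooth hφ i) z
  have hc := fun i => smd hφ (cph_smooth hφ i) z
  have hg := fun i j => smd hφ (g_smooth hφ i j) z
  have hE : wd k (fun z => Complex.exp (Phi φ z)) z = Complex.exp (Phi φ z) * ph φ k z := wd_exp k hP
  rw [Fintype.sum_option]
  rcases A with _ | i <;> rcases B with _ | j <;> simp only [Hmet, Acon]
  · rw [hE]; simp
  · rw [wd_mul k he (hc j), hE, wd_cph hφ]; simp; ring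
  · rw [wd_mul k he (hph i), hE]
    simp only [add_mul, Finset.sum_add_distrib, mul_assoc]
    simp only [ite_mul, mul_ite, one_mul, zero_mul, mul_zero, Finset.sum_ite_eq', Finset.sum_ite_eq, Finset.mem_univ, if_true]
    have : ∑ m, Gam φ m k i z * (Complex.exp (Phi φ z) * ph φ m z)
      = Complex.exp (Phi φ z) * ∑ m, Gam φ m k i z * ph φ m z := by
      rw [Finset.mul_sum]; exact Finset.sum_congr rfl fun m _ => by ring
    rw [this]; ring
  · rw [wd_mul k he ((hg i j).fun_add ((hph i).fun_mul (hc j))), hE, wd_add k (hg i j) ((hph i).fun_mul (hc j)),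
      wd_mul k (hph i) (hc j), wd_cph hφ]
    simp only [add_mul, Finset.sum_add_distrib, mul_assoc]
    simp only [ite_mul, mul_ite, one_mul, zero_mul, mul_zero, Finset.sum_ite_eq', Finset.sum_ite_eq, Finset.mem_univ, if_true]
    have : ∑ m, Gam φ m k i z * (Complex.exp (Phi φ z) * (gmat φ m j z + ph φ m z * conj (ph φ j z)))
      = Complex.exp (Phi φ z) * (wd k (gmat φ i j) z + (∑ m, Gam φ m k i z * ph φ m z) * conj (ph φ j z)) := by
      rw [← Gam_g hd, Finset.sum_mul, ← Finset.sum_add_distrib, Finset.mul_sum]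
      exact Finset.sum_congr rfl fun m _ => by ring
    rw [this]; ring

lemma wdb_H (hφ : ContDiff ℝ (⊤ : ℕ∞) φ) {z} (hd : (Matrix.of fun i j => gmat φ i j z).det ≠ 0) (k : Fin n) (A B : Option (Fin n)) :
    wdb k (fun y => Hmet φ y A B) z = ∑ C, Hmet φ z A C * conj (Acon φ k z B C) := by
  have : (fun y => Hmet φ y A B) = fun y => conj (Hmet φ y B A) := by
    funext y; rw [conj_H hφ]
  rw [this, wdb_conj, wd_H hφ hd, map_sum]
  refine Finset.sum_congr rfl fun C _ => ?_
  rw [map_mul, conj_H hφ, mul_comm]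

lemma Acon_smooth (hφ : ContDiff ℝ (⊤ : ℕ∞) φ) {z} (hd : (Matrix.of fun i j => gmat φ i j z).det ≠ 0) (k : Fin n) (A B : Option (Fin n)) :
    ContDiffAt ℝ (⊤ : ℕ∞) (fun y => Acon φ k y A B) z := by
  have hG := fun m k i => Gam_smooth hφ hd m k i
  have hp := fun i => (ph_smooth hφ i).contDiffAt (x := z)
  rcases A with _ | i <;> rcases B with _ | m <;> simp only [Acon]
  · exact contDiffAt_const
  · exact contDiffAt_const
  · exact ((((ph_smooth hφ i).wd' k).contDiffAt).sub ((hp k).mul (hp i))).sub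
      (ContDiffAt.sum fun m _ => (hG m k i).mul (hp m))
  · exact ((hG m k i).add ((hp k).mul contDiffAt_const)).add ((hp i).mul contDiffAt_const)

lemma wdb_Acon (hφ : ContDiff ℝ (⊤ : ℕ∞) φ) {z} (hd : ∀ᶠ y in 𝓝 z, (Matrix.of fun i j => gmat φ i j y).det ≠ 0)
    (hc : ∀ i j k l : Fin n,
      Riem (gmat φ) i j k l z
        = gmat φ i j z * gmat φ k l z + gmat φ i l z * gmat φ k j z) (k l : Fin n) (A B : Option (Fin n)) :
    wdb l (fun y => Acon φ k y A B) z = 0 := by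
  have hd0 := hd.self_of_nhds
  have hG : ∀ m i, DifferentiableAt ℝ (Gam φ m k i) z := fun m i =>
    (Gam_smooth hφ hd0 m k i).differentiableAt (by simp)
  have hph := fun i => smd hφ (ph_smooth hφ i) z
  rcases A with _ | i <;> rcases B with _ | m <;> simp only [Acon]
  · exact wdb_const l _
  · exact wdb_const l _
  · have h1 : DifferentiableAt ℝ (wd k (ph φ i)) z := smd hφ ((ph_smooth hφ i).wd' k) z
    have h2 : DifferentiableAt ℝ (fun y => ph φ k y * ph φ i y) z := (hph k).fun_mul (hph i)
    have h3 : ∀ m, DifferentiableAt ℝ (fun y => Gam φ m k i y * ph φ m y) z :=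
      fun m => (hG m i).fun_mul (hph m)
    have h4 : DifferentiableAt ℝ (fun y => ∑ m, Gam φ m k i y * ph φ m y) z :=
      DifferentiableAt.fun_sum fun m _ => h3 m
    rw [wdb_sub l (h1.fun_sub h2) h4, wdb_sub l h1 h2, wdb_mul l (hph k) (hph i),
      wdb_sum l _ _ (fun m _ => h3 m), ← wd_wdb_comm (smooth2 hφ (ph_smooth hφ i) z)]
    have e : wdb l (ph φ i) = gmat φ i l := funext fun y => wdb_ph hφ i l y
    simp only [wdb_mul l (hG _ i) (hph _), wdb_ph hφ, wdb_Gam hφ hd hc, e]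
    rw [Finset.sum_add_distrib, Gam_g hd0]
    simp only [neg_mul, add_mul, Finset.sum_add_distrib, Finset.sum_neg_distrib]
    simp only [ite_mul, one_mul, zero_mul, Finset.sum_ite_eq', Finset.mem_univ, if_true]
    ring
  · have h1 : ∀ (c : ℂ) i, DifferentiableAt ℝ (fun y => ph φ i y * c) z :=
      fun c i => (hph i).fun_mul (differentiableAt_const c)
    rw [wdb_add l ((hG m i).fun_add (h1 _ k)) (h1 _ i), wdb_add l (hG m i) (h1 _ k),
      wdb_mul l (hph k) (differentiableAt_const _), wdb_mul l (hph i) (differentiableAt_const _),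
      wdb_const, wdb_const, wdb_Gam hφ hd hc, wdb_ph hφ, wdb_ph hφ]
    ring
end G
end

section
open Complex Matrix
open scoped ComplexOrder
open Filter Topology
open scoped ComplexConjugate

section F0
attribute [local instance] Matrix.frobeniusNormedAddCommGroup Matrix.frobeniusNormedSpace
  Matrix.frobeniusNormedRing Matrix.frobeniusNormedAlgebra

/-- square matrices with the Frobenius norm, as a type synonym -/
def MA (n : ℕ) : Type := Matrix (Option (Fin n)) (Option (Fin n)) ℂ

instance MA.nr (n : ℕ) : NormedRing (MA n) :=
  inferInstanceAs (NormedRing (Matrix (Option (Fin n)) (Option (Fin n)) ℂ))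
instance MA.na (n : ℕ) : NormedAlgebra ℂ (MA n) :=
  inferInstanceAs (NormedAlgebra ℂ (Matrix (Option (Fin n)) (Option (Fin n)) ℂ))
instance MA.sr (n : ℕ) : StarRing (MA n) :=
  inferInstanceAs (StarRing (Matrix (Option (Fin n)) (Option (Fin n)) ℂ))
instance MA.nsg (n : ℕ) : NormedStarGroup (MA n) :=
  inferInstanceAs (NormedStarGroup (Matrix (Option (Fin n)) (Option (Fin n)) ℂ))
instance MA.sm (n : ℕ) : StarModule ℂ (MA n) :=
  inferInstanceAs (StarModule ℂ (Matrix (Option (Fin n)) (Option (Fin n)) ℂ))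
instance MA.fd (n : ℕ) : FiniteDimensional ℂ (MA n) :=
  inferInstanceAs (FiniteDimensional ℂ (Matrix (Option (Fin n)) (Option (Fin n)) ℂ))
instance MA.cs (n : ℕ) : CompleteSpace (MA n) := FiniteDimensional.complete ℂ (MA n)

/-- entry functional, linear -/
def entL (n : ℕ) (A B : Option (Fin n)) : MA n →ₗ[ℂ] ℂ := Matrix.entryLinearMap ℂ ℂ A B
/-- entry functional -/
def ent (n : ℕ) (A B : Option (Fin n)) : MA n →L[ℂ] ℂ := LinearMap.toContinuousLinearMap (entL n A B)
/-- matrix from entries -/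
def mkM {n : ℕ} (h : Option (Fin n) → Option (Fin n) → ℂ) : MA n := Matrix.of h

variable {n : ℕ}
lemma ent_mkM (h : Option (Fin n) → Option (Fin n) → ℂ) (A B) : ent n A B (mkM h) = h A B := rfl
lemma ent_mul (M N : MA n) (A B) : ent n A B (M * N) = ∑ C, ent n A C M * ent n C B N :=
  Matrix.mul_apply (M := M) (N := N)
lemma ent_star (M : MA n) (A B) : ent n A B (star M) = conj (ent n B A M) := rfl
lemma ent_one (A B) : ent n A B 1 = if A = B then 1 else 0 :=
  Matrix.one_apply (n := Option (Fin n)) (α := ℂ)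
lemma ent_ext {M N : MA n} (h : ∀ A B, ent n A B M = ent n A B N) : M = N :=
  Matrix.ext h
/-- elementary matrices -/
def sgl (A B : Option (Fin n)) : MA n := Matrix.single A B (1:ℂ)
lemma ent_sgl (A B C D : Option (Fin n)) : ent n C D (sgl A B) = if A = C ∧ B = D then 1 else 0 :=
  Matrix.single_apply A B (1:ℂ) C D
end F0

section F
variable {n : ℕ}
/-- elementary coefficient forms -/
def TT (k : Fin n) (A B : Option (Fin n)) : EuclideanSpace ℂ (Fin n) →L[ℂ] MA n :=
  (EuclideanSpace.proj k : EuclideanSpace ℂ (Fin n) →L[ℂ] ℂ).smulRight (sgl A B)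

lemma TT_apply (k : Fin n) (A B C D : Option (Fin n)) (v : EuclideanSpace ℂ (Fin n)) :
    ent n C D (TT k A B v) = if A = C ∧ B = D then v k else 0 := by
  simp [TT, ent_sgl]

lemma sum_pick (f : Option (Fin n) → Option (Fin n) → ℂ) (C D : Option (Fin n)) :
    ∑ A, ∑ B, (if A = C ∧ B = D then f A B else 0) = f C D := by
  rw [Finset.sum_eq_single C, Finset.sum_eq_single D]
  · simp
  · intro b _ hb; simp [hb]
  · simp
  · intro b _ hb; simp [hb]
  · simp

lemma mat_eq (h : Option (Fin n) → Option (Fin n) → ℂ) :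
    mkM h = ∑ A, ∑ B, h A B • sgl A B := by
  refine ent_ext fun C D => ?_
  simp only [map_sum, map_smul, ent_mkM, ent_sgl, smul_eq_mul, mul_ite, mul_one, mul_zero]
  rw [sum_pick]

lemma frame_row {φ : EuclideanSpace ℂ (Fin n) → ℝ} (hφ : ContDiff ℝ (⊤ : ℕ∞) φ)
    (p : EuclideanSpace ℂ (Fin n))
    (hd : ∀ᶠ y in 𝓝 p, (Matrix.of fun i j => gmat φ i j y).det ≠ 0)
    (hc : ∀ᶠ z in 𝓝 p, ∀ i j k l : Fin n, Riem (gmat φ) i j k l z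
        = gmat φ i j z * gmat φ k l z + gmat φ i l z * gmat φ k j z) :
    ∃ w : Option (Fin n) → EuclideanSpace ℂ (Fin n) → ℂ,
      (∀ B, ContDiffAt ℝ 2 (w B) p) ∧
      (∀ᶠ z in 𝓝 p, (∀ B, DifferentiableAt ℂ (w B) z) ∧
        Hmet φ z none none = ∑ B, ∑ C, w B z * Hmet φ p B C * conj (w C z)) ∧
      w none p = 1 ∧ (∀ i, w (some i) p = 0) ∧ (∀ v, fderiv ℂ (w none) p v = 0) ∧
      ∀ i v, fderiv ℂ (w (some i)) p v = v i := by
  have hex : ∀ k A B, ∃ g : EuclideanSpace ℂ (Fin n) → ℂ, ContDiff ℝ (⊤ : ℕ∞) g ∧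
      g =ᶠ[𝓝 p] fun y => Acon φ k y A B := fun k A B =>
    exists_global_ext _ p (by filter_upwards [hd] with y hy using Acon_smooth hφ hy k A B)
  choose c hcs hce using hex
  let a : EuclideanSpace ℂ (Fin n) → EuclideanSpace ℂ (Fin n) →L[ℂ]
      MA n :=
    fun z => ∑ k, ∑ A, ∑ B, c k A B z • TT k A B
  have a_app : ∀ z v A B, ent n A B (a z v) = ∑ k, v k * c k A B z := by
    intro z v A B
    simp only [a, ContinuousLinearMap.sum_apply, map_sum, ContinuousLinearMap.smul_apply, map_smul,
      TT_apply, smul_eq_mul, mul_ite, mul_zero]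
    refine Finset.sum_congr rfl fun k _ => ?_
    rw [sum_pick (fun A B => c k A B z * v k), mul_comm]
  have ha : ContDiff ℝ 2 a := by
    refine ContDiff.sum fun k _ => ContDiff.sum fun A _ => ContDiff.sum fun B _ => ?_
    exact ((hcs k A B).of_le (WithTop.coe_le_coe.2 le_top)).smul contDiff_const
  have hcd : ∀ᶠ z in 𝓝 p, ∀ k A B, DifferentiableAt ℂ (c k A B) z := by
    simp only [Filter.eventually_all]
    intro k A B
    filter_upwards [hd.eventually_nhds, hc, (hce k A B).eventually_nhds] with z h1 h2 h3
    refine differentiableAt_of_wdb (smd hφ (hcs k A B) z) fun l => ?_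
    rw [wdb_congr l h3]
    exact wdb_Acon hφ h1 h2 k l A B
  have ha' : ∀ᶠ z in 𝓝 p, DifferentiableAt ℂ a z := by
    filter_upwards [hcd] with z hz
    refine DifferentiableAt.fun_sum fun k _ => DifferentiableAt.fun_sum fun A _ =>
      DifferentiableAt.fun_sum fun B _ => (hz k A B).smul (differentiableAt_const _)
  let H : EuclideanSpace ℂ (Fin n) → MA n :=
    fun z => mkM (Hmet φ z)
  have hHd : ∀ z, DifferentiableAt ℝ H z := by
    intro z
    have : H = fun z => ∑ A, ∑ B, Hmet φ z A B • sgl A B := by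
      funext z; exact mat_eq _
    rw [this]
    refine DifferentiableAt.fun_sum fun A _ =>
      DifferentiableAt.fun_sum fun B _ => (smd hφ (H_smooth hφ A B) z).smul (differentiableAt_const _)
  have hH : ∀ᶠ z in 𝓝 p, DifferentiableAt ℝ H z ∧
      ∀ v, fderiv ℝ H z v = a z v * H z + H z * star (a z v) := by
    have hce' : ∀ᶠ z in 𝓝 p, ∀ k A B, c k A B z = Acon φ k z A B := by
      simp only [Filter.eventually_all]
      exact hce
    filter_upwards [hd, hce'] with z h1 h2
    refine ⟨hHd z, fun v => ?_⟩
    refine ent_ext fun A B => ?_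
    have e1 : ent n A B (fderiv ℝ H z v) = fderiv ℝ (fun y => Hmet φ y A B) z v := by
      have h3 : HasFDerivAt (fun y => Hmet φ y A B)
          (((ent n A B).restrictScalars ℝ).comp (fderiv ℝ H z)) z :=
        (((ent n A B).restrictScalars ℝ).hasFDerivAt).comp z (hHd z).hasFDerivAt
      rw [h3.fderiv]; rfl
    rw [e1, fderiv_eq_wd, map_add, ent_mul, ent_mul]
    simp only [wd_H hφ h1, wdb_H hφ h1, a_app, ent_star, h2, H, ent_mkM]
    rw [Finset.sum_add_distrib]
    congr 1
    · simp only [Finset.mul_sum, Finset.sum_mul]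
      rw [Finset.sum_comm]
      exact Finset.sum_congr rfl fun C _ => Finset.sum_congr rfl fun k _ => by ring
    · simp only [Finset.mul_sum, Finset.sum_mul, map_sum]
      rw [Finset.sum_comm]
      exact Finset.sum_congr rfl fun C _ => Finset.sum_congr rfl fun k _ => by simp; ring
  obtain ⟨W, hW2, hWd, hWp, hWf⟩ := exists_frame p a ha ha' H hH
  have hWdp := hWd.self_of_nhds.1
  have hfd : ∀ B v, fderiv ℂ (fun z => ent n none B (W z)) p v = ent n none B (a p v) := by
    intro B v
    have h3 : HasFDerivAt (fun y => ent n none B (W y)) ((ent n none B).comp (fderiv ℂ W p)) p :=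
      ((ent n none B).hasFDerivAt).comp p hWdp.hasFDerivAt
    rw [h3.fderiv, ← hWf]; rfl
  have hcp : ∀ k A B, c k A B p = Acon φ k p A B := fun k A B => (hce k A B).self_of_nhds
  refine ⟨fun B z => ent n none B (W z), fun B => ?_, ?_, ?_, ?_, ?_, ?_⟩
  · exact (((ent n none B).restrictScalars ℝ).contDiff.contDiffAt).comp p hW2
  · filter_upwards [hWd] with z hz
    refine ⟨fun B => ((ent n none B).differentiableAt).comp z hz.1, ?_⟩
    have := congrArg (ent n none none) hz.2
    simp only [ent_mul, H, ent_mkM, ent_star] at this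
    rw [this, Finset.sum_comm]
    exact Finset.sum_congr rfl fun C _ => by rw [Finset.sum_mul]
  · simp [hWp, ent_one]
  · intro i; simp [hWp, ent_one]
  · intro v; rw [hfd, a_app]; simp [hcp, Acon]
  · intro i v; rw [hfd, a_app]; simp [hcp, Acon]
end F
end

section
open Complex Matrix
open scoped ComplexOrder
open Filter Topology
open scoped ComplexConjugate

section K
variable {n : ℕ}

section Fac
open scoped MatrixOrder
lemma factor_g (G : Matrix (Fin n) (Fin n) ℂ) (hG : G.PosDef) :
    ∃ C : Matrix (Fin n) (Fin n) ℂ, (∀ i j, G i j = ∑ a, C a i * conj (C a j)) ∧ C.det ≠ 0 := by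
  obtain ⟨B, hB⟩ := CStarAlgebra.nonneg_iff_eq_star_mul_self.mp hG.posSemidef.nonneg
  refine ⟨B.map conj, fun i j => ?_, ?_⟩
  · rw [hB, Matrix.mul_apply]; simp [Matrix.star_apply]
  · have h1 : G.det ≠ 0 := hG.det_pos.ne'
    rw [hB, Matrix.det_mul] at h1
    have : (B.map conj).det = conj B.det := by
      rw [RingHom.map_det]; rfl
    rw [this]
    simpa using right_ne_zero_of_mul h1
end Fac

lemma inj_near {E : Type} [NormedAddCommGroup E] [NormedSpace ℝ E] [FiniteDimensional ℝ E]
    (f : E → E) (p : E) (hf : ContDiffAt ℝ 2 f p) (hk : ∀ v, fderiv ℝ f p v = 0 → v = 0) :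
    ∃ V ∈ 𝓝 p, Set.InjOn f V := by
  have : CompleteSpace E := FiniteDimensional.complete ℝ E
  have hinj : Function.Injective (fderiv ℝ f p : E →ₗ[ℝ] E) := by
    rw [injective_iff_map_eq_zero]; exact hk
  let e : E ≃L[ℝ] E := (LinearEquiv.ofInjectiveEndo _ hinj).toContinuousLinearEquiv
  have he : (e : E →L[ℝ] E) = fderiv ℝ f p := by ext v; rfl
  have hs : HasStrictFDerivAt f (e : E →L[ℝ] E) p := by
    rw [he]; exact hf.hasStrictFDerivAt (by simp)
  refine ⟨(hs.toOpenPartialHomeomorph f).source, ?_, ?_⟩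
  · exact (hs.toOpenPartialHomeomorph f).open_source.mem_nhds hs.mem_toOpenPartialHomeomorph_source
  · exact (hs.toOpenPartialHomeomorph f).injOn

lemma pluri {l : EuclideanSpace ℂ (Fin n) → ℂ} {p : EuclideanSpace ℂ (Fin n)}
    (h2 : ContDiffAt ℝ 2 l p) (hd : ∀ᶠ z in 𝓝 p, DifferentiableAt ℂ l z) :
    ∀ᶠ z in 𝓝 p, ∀ i j, wd i (wdb j (fun w => l w + conj (l w))) z = 0 := by
  filter_upwards [hd.eventually_nhds, h2.eventually (by simp)] with z hz h2z i j
  have e : wdb j (fun w => l w + conj (l w)) =ᶠ[𝓝 z] fun w => conj (wd j l w) := by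
    filter_upwards [hz] with y hy
    have hr : DifferentiableAt ℝ l y := hy.restrictScalars ℝ
    have hr' : DifferentiableAt ℝ (fun w => conj (l w)) y := Complex.conjCLE.differentiableAt.comp y hr
    rw [wdb_add j hr hr', wdb_eq_zero j hy, zero_add]
    exact wdb_conj j l
  have e2 : wdb i l =ᶠ[𝓝 z] fun _ => 0 := by
    filter_upwards [hz] with y hy using wdb_eq_zero i hy
  rw [wd_congr i e, wd_conj, ← wd_wdb_comm h2z, wd_congr j e2, wd_const, map_zero]

lemma hess_eq {P L l : EuclideanSpace ℂ (Fin n) → ℂ} {p : EuclideanSpace ℂ (Fin n)}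
    (hP : ContDiff ℝ (⊤ : ℕ∞) P)
    (h2 : ContDiffAt ℝ 2 l p) (hd : ∀ᶠ z in 𝓝 p, DifferentiableAt ℂ l z)
    (hL : ∀ᶠ z in 𝓝 p, L z = P z + (l z + conj (l z))) :
    ∀ᶠ z in 𝓝 p, ∀ i j, wd i (wdb j P) z = wd i (wdb j L) z := by
  filter_upwards [(show L =ᶠ[𝓝 p] _ from hL).eventually_nhds, pluri h2 hd,
    (h2.eventually (by simp)).eventually_nhds] with z hz hpz h2z i j
  have hq : ∀ y, ContDiffAt ℝ 2 l y → ContDiffAt ℝ 2 (fun w => l w + conj (l w)) y := fun y hy =>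
    hy.add (Complex.conjCLE.contDiff.contDiffAt.comp y hy)
  have hP1 : ∀ y, DifferentiableAt ℝ P y := fun y => hP.differentiable (by simp) y
  have e : wdb j L =ᶠ[𝓝 z] fun y => wdb j P y + wdb j (fun w => l w + conj (l w)) y := by
    refine (wdb_evEq j hz).trans ?_
    filter_upwards [h2z] with y hy
    exact wdb_add j (hP1 y) ((hq y hy).differentiableAt (by simp))
  rw [wd_congr i e, wd_add i ((hP.wdb' j).differentiable (by simp) z)
    (((hq z h2z.self_of_nhds).wdb' (m' := 1) j (by norm_num)).differentiableAt (by simp)), hpz, add_zero]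

lemma log_add_conj (h : ℂ) : Complex.log h + conj (Complex.log h) = ((2 * Real.log ‖h‖ : ℝ) : ℂ) := by
  rw [Complex.add_conj, Complex.log_re]

lemma local_model {φ : EuclideanSpace ℂ (Fin n) → ℝ} (hφ : ContDiff ℝ (⊤ : ℕ∞) φ)
    (p : EuclideanSpace ℂ (Fin n))
    (hpos : ∀ᶠ y in 𝓝 p, (Matrix.of fun i j => gmat φ i j y).PosDef)
    (hc : ∀ᶠ z in 𝓝 p, ∀ i j k l : Fin n, Riem (gmat φ) i j k l z
        = gmat φ i j z * gmat φ k l z + gmat φ i l z * gmat φ k j z) :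
    ∃ f : EuclideanSpace ℂ (Fin n) → EuclideanSpace ℂ (Fin n),
      (∃ V ∈ 𝓝 p, Set.InjOn f V) ∧ (∀ᶠ z in 𝓝 p, DifferentiableAt ℂ f z) ∧
      ∀ᶠ z in 𝓝 p, ∀ i j, gmat φ i j z
        = wd i (wdb j (fun w => (Real.log (1 + ‖f w‖ ^ 2) : ℂ))) z := by
  obtain ⟨w, hw2, hwd, hwn, hws, hfn, hfs⟩ :=
    frame_row hφ p (hpos.mono fun y hy => hy.det_pos.ne') hc
  obtain ⟨C, hC, hCd⟩ := factor_g _ hpos.self_of_nhds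
  simp only [Matrix.of_apply] at hC
  let h : EuclideanSpace ℂ (Fin n) → ℂ := fun z => w none z + ∑ i, w (some i) z * ph φ i p
  let N : Fin n → EuclideanSpace ℂ (Fin n) → ℂ := fun a z => ∑ i, C a i * w (some i) z
  let F : Fin n → EuclideanSpace ℂ (Fin n) → ℂ := fun a z => N a z * (h z)⁻¹
  let f : EuclideanSpace ℂ (Fin n) → EuclideanSpace ℂ (Fin n) := fun z => WithLp.toLp 2 fun a => F a z
  have hhp : h p = 1 := by simp [h, hwn, hws]
  have hNp : ∀ a, N a p = 0 := by intro a; simp [N, hws]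
  have hh2 : ContDiffAt ℝ 2 h p :=
    (hw2 none).add (ContDiffAt.sum fun i _ => (hw2 _).mul contDiffAt_const)
  have hN2 : ∀ a, ContDiffAt ℝ 2 (N a) p := fun a =>
    ContDiffAt.sum fun i _ => contDiffAt_const.mul (hw2 _)
  have hhd : ∀ z, (∀ B, DifferentiableAt ℂ (w B) z) → DifferentiableAt ℂ h z := fun z hz =>
    (hz none).fun_add (DifferentiableAt.fun_sum fun i _ => (hz _).fun_mul (differentiableAt_const _))
  have hNd : ∀ a z, (∀ B, DifferentiableAt ℂ (w B) z) → DifferentiableAt ℂ (N a) z := fun a z hz =>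
    DifferentiableAt.fun_sum fun i _ => (differentiableAt_const _).fun_mul (hz _)
  have hF2 : ∀ a, ContDiffAt ℝ 2 (F a) p := fun a => (hN2 a).mul (hh2.inv (by rw [hhp]; simp))
  have hFd : ∀ a z, (∀ B, DifferentiableAt ℂ (w B) z) → h z ≠ 0 → DifferentiableAt ℂ (F a) z :=
    fun a z hz h0 => (hNd a z hz).fun_mul ((hhd z hz).inv h0)
  have hf2 : ContDiffAt ℝ 2 f p := (contDiffAt_piLp 2).2 hF2
  have hsl : ∀ᶠ z in 𝓝 p, h z ∈ Complex.slitPlane :=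
    hh2.continuousAt.eventually (Complex.isOpen_slitPlane.mem_nhds (by rw [hhp]; simp))
  have hfd : ∀ᶠ z in 𝓝 p, DifferentiableAt ℂ f z := by
    filter_upwards [hwd, hsl] with z hz hs
    exact differentiableAt_euclidean.2 fun a => hFd a z hz.1 (Complex.slitPlane_ne_zero hs)
  refine ⟨f, inj_near f p hf2 fun v hv => ?_, hfd, ?_⟩
  · have hwp := hwd.self_of_nhds.1
    have hNf : ∀ a, fderiv ℂ (N a) p v = ∑ i, C a i * v i := by
      intro a
      have : HasFDerivAt (N a) (∑ i, C a i • fderiv ℂ (w (some i)) p) p :=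
        HasFDerivAt.fun_sum fun i _ => (hwp (some i)).hasFDerivAt.const_mul (C a i)
      rw [this.fderiv]; simp [hfs]
    have hFf : ∀ a, fderiv ℂ (F a) p v = ∑ i, C a i * v i := by
      intro a
      have hi : DifferentiableAt ℂ (fun z => (h z)⁻¹) p := (hhd p hwp).inv (by rw [hhp]; simp)
      have := (hNd a p hwp).hasFDerivAt.mul hi.hasFDerivAt
      have h3 : fderiv ℂ (F a) p = _ := this.fderiv
      rw [h3]; simp [hNp, hhp, hNf]
    have hFr : ∀ a, fderiv ℝ (F a) p v = ∑ i, C a i * v i := by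
      intro a
      have := (hFd a p hwp (by rw [hhp]; simp)).hasFDerivAt.restrictScalars ℝ
      rw [this.fderiv, ← hFf]; rfl
    have hcomp : ∀ a, (fderiv ℝ f p v) a = fderiv ℝ (F a) p v := by
      intro a
      have h3 := (((EuclideanSpace.proj a : EuclideanSpace ℂ (Fin n) →L[ℂ] ℂ).restrictScalars
        ℝ).hasFDerivAt).comp p (hf2.differentiableAt (by simp)).hasFDerivAt
      have h4 : fderiv ℝ (F a) p = _ := h3.fderiv
      rw [h4]; rfl
    have : C *ᵥ (fun i => v i) = 0 := by
      funext a
      have h5 := hcomp a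
      rw [hv, hFr] at h5
      simpa [Matrix.mulVec, dotProduct] using h5.symm
    have h6 := Matrix.eq_zero_of_mulVec_eq_zero hCd this
    ext i
    exact congrFun h6 i
  · have key : ∀ᶠ z in 𝓝 p, φ z = φ p + 2 * Real.log ‖h z‖ + Real.log (1 + ‖f z‖ ^ 2) := by
      filter_upwards [hwd, hsl] with z hz hs
      have h0 := Complex.slitPlane_ne_zero hs
      have e1 := hz.2
      have e2 : ∑ B, ∑ D, w B z * Hmet φ p B D * conj (w D z)
          = Complex.exp (Phi φ p) * (h z * conj (h z) + ∑ a, N a z * conj (N a z)) := by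
        have e3 : ∑ a, N a z * conj (N a z)
            = ∑ i, ∑ j, w (some i) z * gmat φ i j p * conj (w (some j) z) := by
          simp only [N, hC, map_sum, map_mul, Finset.sum_mul_sum]
          rw [Finset.sum_comm]
          refine Finset.sum_congr rfl fun i _ => ?_
          rw [Finset.sum_comm]
          refine Finset.sum_congr rfl fun j _ => ?_
          rw [Finset.mul_sum, Finset.sum_mul]
          exact Finset.sum_congr rfl fun a _ => by ring
        rw [e3]
        simp only [Fintype.sum_option, Hmet, h, map_add, map_sum, map_mul]
        set E0 := Complex.exp (Phi φ p)
        have A1 : ∑ j, w none z * (E0 * conj (ph φ j p)) * conj (w (some j) z)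
            = E0 * w none z * ∑ j, conj (w (some j) z) * conj (ph φ j p) := by
          rw [Finset.mul_sum]; exact Finset.sum_congr rfl fun j _ => by ring
        have A2 : ∑ i, w (some i) z * (E0 * ph φ i p) * conj (w none z)
            = E0 * conj (w none z) * ∑ i, w (some i) z * ph φ i p := by
          rw [Finset.mul_sum]; exact Finset.sum_congr rfl fun j _ => by ring
        have A3 : ∑ i, ∑ j, w (some i) z * (E0 * (gmat φ i j p + ph φ i p * conj (ph φ j p)))
              * conj (w (some j) z)
            = E0 * ((∑ i, ∑ j, w (some i) z * gmat φ i j p * conj (w (some j) z))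
              + (∑ i, w (some i) z * ph φ i p) * ∑ j, conj (w (some j) z) * conj (ph φ j p)) := by
          rw [Finset.sum_mul_sum, ← Finset.sum_add_distrib, Finset.mul_sum]
          refine Finset.sum_congr rfl fun i _ => ?_
          rw [← Finset.sum_add_distrib, Finset.mul_sum]
          exact Finset.sum_congr rfl fun j _ => by ring
        rw [Finset.sum_add_distrib, A1, A2, A3]
        ring
      have hnf : ‖f z‖ ^ 2 = (∑ a, ‖N a z‖ ^ 2) / ‖h z‖ ^ 2 := by
        rw [EuclideanSpace.norm_sq_eq, Finset.sum_div]
        refine Finset.sum_congr rfl fun a _ => ?_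
        simp [f, F, mul_pow, div_eq_mul_inv]
      have e4 : Real.exp (φ z) = Real.exp (φ p) * (‖h z‖ ^ 2 * (1 + ‖f z‖ ^ 2)) := by
        have hn0 : ‖h z‖ ^ 2 ≠ 0 := by simpa using h0
        rw [hnf, mul_add, mul_one, mul_div_cancel₀ _ hn0]
        rw [e2] at e1
        simp only [Hmet, Phi, Complex.mul_conj'] at e1
        exact_mod_cast e1
      have hn0 : ‖h z‖ ≠ 0 := by simpa using h0
      have hn1 : 1 + ‖f z‖ ^ 2 ≠ 0 := by positivity
      rw [← Real.log_exp (φ z), e4, Real.log_mul (Real.exp_pos _).ne' (by positivity),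
        Real.log_mul (by positivity) hn1, Real.log_exp, Real.log_pow]
      push_cast; ring
    have hl2 : ContDiffAt ℝ 2 (fun z => -(Complex.log (h z)) - (φ p : ℂ) / 2) p := by
      refine ContDiffAt.sub (ContDiffAt.neg ?_) contDiffAt_const
      have : ContDiffAt ℝ 2 Complex.log (h p) :=
        (Complex.contDiffAt_log hsl.self_of_nhds).restrict_scalars ℝ
      exact this.comp p hh2
    have hld : ∀ᶠ z in 𝓝 p, DifferentiableAt ℂ (fun z => -(Complex.log (h z)) - (φ p : ℂ) / 2) z := by
      filter_upwards [hwd, hsl] with z hz hs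
      exact (((hhd z hz.1).clog hs).fun_neg).fun_sub (differentiableAt_const _)
    refine hess_eq (Phi_smooth hφ) hl2 hld ?_
    filter_upwards [key] with z hz
    have h1 := log_add_conj (h z)
    simp only [Phi, map_sub, map_neg, map_div₀, Complex.conj_ofReal]
    rw [hz]
    have h2 : conj (2:ℂ) = 2 := Complex.conj_ofReal 2
    rw [h2]
    push_cast at h1 ⊢
    linear_combination h1
end K
end

end Helpers

/-- A Kähler metric `g_{ij̄} = ∂_i∂_j̄ φ` on the unit ball of `ℂⁿ` with
constant holomorphic sectional curvature `κ = 2` is locally the pull-back of the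
Fubini–Study metric by an injective holomorphic map. -/
theorem chsc_two_local_model (n : ℕ) (φ : EuclideanSpace ℂ (Fin n) → ℝ)
    (hφ : ContDiffOn ℝ (⊤ : ℕ∞) φ (Metric.ball 0 1))
    (hpos : ∀ z ∈ Metric.ball (0 : EuclideanSpace ℂ (Fin n)) 1,
      (Matrix.of fun i j => gmat φ i j z).PosDef)
    (hchsc : ∀ z ∈ Metric.ball (0 : EuclideanSpace ℂ (Fin n)) 1, ∀ i j k l : Fin n,
      Riem (gmat φ) i j k l z
        = gmat φ i j z * gmat φ k l z + gmat φ i l z * gmat φ k j z) :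
    ∀ p ∈ Metric.ball (0 : EuclideanSpace ℂ (Fin n)) 1,
      ∃ U : Set (EuclideanSpace ℂ (Fin n)), IsOpen U ∧ p ∈ U ∧ U ⊆ Metric.ball 0 1 ∧
        ∃ f : EuclideanSpace ℂ (Fin n) → EuclideanSpace ℂ (Fin n),
          Set.InjOn f U ∧ DifferentiableOn ℂ f U ∧
          ∀ z ∈ U, ∀ i j : Fin n,
            gmat φ i j z
              = wd i (wdb j (fun w => (Real.log (1 + ‖f w‖ ^ 2) : ℂ))) z := by
  intro p hp
  have hball : ∀ᶠ z in nhds p, z ∈ Metric.ball (0 : EuclideanSpace ℂ (Fin n)) 1 :=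
    Metric.isOpen_ball.mem_nhds hp
  obtain ⟨ψ, hψ, hψe⟩ := exists_global_ext φ p (by
    filter_upwards [hball] with z hz
    exact (hφ z hz).contDiffAt (Metric.isOpen_ball.mem_nhds hz))
  have hg : ∀ i j, gmat ψ i j =ᶠ[nhds p] gmat φ i j := by
    intro i j
    have h1 : (fun w => (ψ w : ℂ)) =ᶠ[nhds p] fun w => (φ w : ℂ) := by
      filter_upwards [hψe] with z hz
      rw [hz]
    exact wd_evEq i (wdb_evEq j h1)
  have hga : ∀ᶠ z in nhds p, ∀ i j, gmat ψ i j =ᶠ[nhds z] gmat φ i j := by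
    simp only [Filter.eventually_all]
    exact fun i j => (hg i j).eventually_nhds
  obtain ⟨f, ⟨V, hV, hinj⟩, hfd, hfe⟩ := local_model hψ p (by
      filter_upwards [hball, hga] with z hz hgz
      have h1 : (Matrix.of fun i j => gmat ψ i j z) = Matrix.of fun i j => gmat φ i j z := by
        ext i j
        exact (hgz i j).self_of_nhds
      rw [h1]
      exact hpos z hz) (by
      filter_upwards [hball, hga] with z hz hgz i j k l
      have h0 : ∀ i j, gmat ψ i j z = gmat φ i j z := fun i j => (hgz i j).self_of_nhds
      have h1 : Riem (gmat ψ) i j k l z = Riem (gmat φ) i j k l z := by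
        simp only [Riem, ginv, h0]
        rw [wd_congr k (wdb_evEq l (hgz i j))]
        congr 1
        refine Finset.sum_congr rfl fun a _ => Finset.sum_congr rfl fun b _ => ?_
        rw [wdb_congr l (hgz a j), wd_congr k (hgz i b)]
      rw [h1, hchsc z hz, h0, h0, h0, h0])
  obtain ⟨U, hU, hUo, hpU⟩ := eventually_nhds_iff.1
    (((hball.and hV).and (hfd.and hfe)).and hga)
  refine ⟨U, hUo, hpU, fun z hz => (hU z hz).1.1.1, f,
    hinj.mono fun z hz => (hU z hz).1.1.2,
    fun z hz => (hU z hz).1.2.1.differentiableWithinAt, fun z hz i j => ?_⟩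
  rw [← (hU z hz).1.2.2 i j]
  exact ((hU z hz).2 i j).self_of_nhds.symm
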